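/- (Theorem 2, tabular local-maximum form.) In the tabular parametrization of the previous statement (S, A finite; π_s : ℝ^m → ℝ^A differentiable probability vectors; π_u(a|s) = π_s(u_s)(a); V_u the unique fixed point of T_{π_u}; Q_u(s,a) = Σ_{s'} P(s'|s,a)(R(s,a,s') + γ(s') V_u(s')); d : S → ℝ nonnegative; g(u)_s = d(s) Σ_a Q_u(s,a) ∇_θ[π_s(θ)(a)]|_{θ=u_s}), if u is a local maximum of the objective J(u) = Σ_s d(s) V_u(s), then g(u) = 0. -/

import Mathlib

/-- A supersolution of the homogeneous discounted evaluation equation is nonnegative. -/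
theorem nonneg_of_discounted_average_le {S A : Type*} [Fintype S] [Fintype A]
    {P : S → A → S → ℝ} {γ : S → ℝ} {c : ℝ}
    (hP0 : ∀ s a s', 0 ≤ P s a s') (hP1 : ∀ s a, ∑ s', P s a s' = 1)
    (hγc : ∀ s, γ s ≤ c) (hγ0 : ∀ s, 0 ≤ γ s) (hc : c < 1)
    {p : S → A → ℝ} (hp0 : ∀ s a, 0 ≤ p s a) (hp1 : ∀ s, ∑ a, p s a = 1)
    {W : S → ℝ} (hW : ∀ s, ∑ a, p s a * ∑ s', P s a s' * (γ s' * W s') ≤ W s) (s : S) :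
    0 ≤ W s := by
  have : Nonempty S := ⟨s⟩
  obtain ⟨x, hx⟩ := Finite.exists_min W
  refine le_trans ?_ (hx s)
  by_contra! hneg
  have hγW : ∀ s', c * W x ≤ γ s' * W s' := fun s' => by
    nlinarith [mul_le_mul_of_nonneg_left (hx s') (hγ0 s'), hγc s']
  have hinner : ∀ a, c * W x ≤ ∑ s', P x a s' * (γ s' * W s') := fun a => by
    calc c * W x = ∑ s', P x a s' * (c * W x) := by rw [← Finset.sum_mul, hP1, one_mul]
      _ ≤ _ := Finset.sum_le_sum fun s' _ => mul_le_mul_of_nonneg_left (hγW s') (hP0 x a s')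
  have houter : c * W x ≤ W x := by
    calc c * W x = ∑ a, p x a * (c * W x) := by rw [← Finset.sum_mul, hp1, one_mul]
      _ ≤ ∑ a, p x a * ∑ s', P x a s' * (γ s' * W s') :=
        Finset.sum_le_sum fun a _ => mul_le_mul_of_nonneg_left (hinner a) (hp0 x a)
      _ ≤ W x := hW x
  nlinarith

/-- Policy improvement: if `V'` is the value function of `p` and `V` is a subsolution of the
Bellman equation of `p`, then `V'` dominates the one-step update of `V`. -/
theorem bellman_le_value_of_le_bellman {S A : Type*} [Fintype S] [Fintype A]
    {P R : S → A → S → ℝ} {γ : S → ℝ} {c : ℝ}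
    (hP0 : ∀ s a s', 0 ≤ P s a s') (hP1 : ∀ s a, ∑ s', P s a s' = 1)
    (hγc : ∀ s, γ s ≤ c) (hγ0 : ∀ s, 0 ≤ γ s) (hc : c < 1)
    {p : S → A → ℝ} (hp0 : ∀ s a, 0 ≤ p s a) (hp1 : ∀ s, ∑ a, p s a = 1)
    {V V' : S → ℝ}
    (hV' : ∀ s, V' s = ∑ a, p s a * ∑ s', P s a s' * (R s a s' + γ s' * V' s'))
    (hV : ∀ s, V s ≤ ∑ a, p s a * ∑ s', P s a s' * (R s a s' + γ s' * V s')) (s : S) :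
    ∑ a, p s a * ∑ s', P s a s' * (R s a s' + γ s' * V s') ≤ V' s := by
  have hdiff : ∀ s, V' s - ∑ a, p s a * ∑ s', P s a s' * (R s a s' + γ s' * V s') =
      ∑ a, p s a * ∑ s', P s a s' * (γ s' * (V' s' - V s')) := fun s => by
    rw [hV' s, ← Finset.sum_sub_distrib]
    refine Finset.sum_congr rfl fun a _ => ?_
    rw [← mul_sub, ← Finset.sum_sub_distrib]
    congr 1
    exact Finset.sum_congr rfl fun s' _ => by ring
  have hW : ∀ s, 0 ≤ V' s - V s :=
    nonneg_of_discounted_average_le hP0 hP1 hγc hγ0 hc hp0 hp1 (W := fun s => V' s - V s)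
      fun s => by linarith [hdiff s, hV s]
  rw [← sub_nonneg, hdiff]
  exact Finset.sum_nonneg fun a _ => mul_nonneg (hp0 s a) <| Finset.sum_nonneg fun s' _ =>
    mul_nonneg (hP0 s a s') <| mul_nonneg (hγ0 s') (hW s')

/-- A linear combination of gradients vanishes at a local maximum of the corresponding linear
combination of functions. -/
theorem IsLocalMax.sum_smul_gradient_eq_zero {ι E : Type*} [Fintype ι] [NormedAddCommGroup E]
    [InnerProductSpace ℝ E] [CompleteSpace E] {f : ι → E → ℝ} {q : ι → ℝ} {x : E}
    (hf : ∀ i, DifferentiableAt ℝ (f i) x) (hmax : IsLocalMax (fun y => ∑ i, q i * f i y) x) :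
    ∑ i, q i • gradient (f i) x = 0 := by
  have hderiv : HasFDerivAt (fun y => ∑ i, q i * f i y) (∑ i, q i • fderiv ℝ (f i) x) x :=
    HasFDerivAt.fun_sum fun i _ => (hf i).hasFDerivAt.const_mul (q i)
  have hzero := congrArg (InnerProductSpace.toDual ℝ E).symm (hmax.hasFDerivAt_eq_zero hderiv)
  simpa [gradient, map_sum] using hzero


/-- Theorem 2, tabular local-maximum form: in the tabular parametrization,
if `u` is a local maximum of the objective `J(u) = Σ_s d(s) V_u(s)`, then the
approximate gradient `g(u)` vanishes, i.e. for every state `s`,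
`d(s) Σ_a Q_u(s,a) ∇_θ π_s(θ)(a)|_{θ=u_s} = 0`. -/
theorem tabular_local_max_approx_gradient_zero
    {S A : Type} [Fintype S] [Fintype A] [Nonempty S] [Nonempty A] {m : ℕ}
    (P R : S → A → S → ℝ) (γ : S → ℝ) (c : ℝ)
    (hP0 : ∀ s a s', 0 ≤ P s a s') (hP1 : ∀ s a, ∑ s', P s a s' = 1)
    (hγ0 : ∀ s, 0 ≤ γ s) (hγc : ∀ s, γ s ≤ c) (hc : c < 1)
    (πs : S → EuclideanSpace ℝ (Fin m) → A → ℝ)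
    (hdiff : ∀ s a θ, DifferentiableAt ℝ (fun θ' => πs s θ' a) θ)
    (hpos : ∀ s θ a, 0 ≤ πs s θ a) (hsum : ∀ s θ, ∑ a, πs s θ a = 1)
    (V : (S → EuclideanSpace ℝ (Fin m)) → S → ℝ)
    (hV : ∀ u s, V u s = ∑ a, πs s (u s) a * ∑ s', P s a s' * (R s a s' + γ s' * V u s'))
    (Q : (S → EuclideanSpace ℝ (Fin m)) → S → A → ℝ)
    (hQ : ∀ u s a, Q u s a = ∑ s', P s a s' * (R s a s' + γ s' * V u s'))
    (d : S → ℝ) (hd : ∀ s, 0 ≤ d s)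
    (J : (S → EuclideanSpace ℝ (Fin m)) → ℝ) (hJ : ∀ u, J u = ∑ s, d s * V u s)
    (u : S → EuclideanSpace ℝ (Fin m)) (hmax : IsLocalMax J u) :
    ∀ s, d s • ∑ a, Q u s a • gradient (fun θ => πs s θ a) (u s) = 0 := by
  classical
  intro s
  rcases (hd s).eq_or_lt with h0 | hds
  · rw [← h0, zero_smul]
  rw [IsLocalMax.sum_smul_gradient_eq_zero (f := fun a θ => πs s θ a) (fun a => hdiff s a _),
    smul_zero]
  have hcont : Filter.Tendsto (Function.update u s) (nhds (u s)) (nhds u) := by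
    have h : Continuous (Function.update u s) := continuous_const.update s continuous_id
    simpa using h.tendsto (u s)
  filter_upwards [hcont.eventually hmax] with θ hθ
  by_contra! hlt
  have hVQ : ∀ v x, V v x = ∑ a, Q v x a * πs x (v x) a := fun v x => by
    simp only [hV v x, hQ, mul_comm]
  rw [← hVQ] at hlt
  have hGθ : ∑ a, πs s (Function.update u s θ s) a *
      ∑ s', P s a s' * (R s a s' + γ s' * V u s') = ∑ a, Q u s a * πs s θ a := by
    simp only [Function.update_self, hQ, mul_comm]
  have hsub : ∀ x, V u x ≤ ∑ a, πs x (Function.update u s θ x) a *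
      ∑ s', P x a s' * (R x a s' + γ s' * V u s') := fun x => by
    by_cases hx : x = s
    · subst hx
      exact hGθ ▸ hlt.le
    · rw [Function.update_of_ne hx]
      exact (hV u x).le
  have himp := bellman_le_value_of_le_bellman hP0 hP1 hγc hγ0 hc (fun x => hpos x _)
    (fun x => hsum x _) (hV (Function.update u s θ)) hsub
  refine absurd hθ (not_le.mpr ?_)
  rw [hJ, hJ]
  refine Finset.sum_lt_sum
    (fun x _ => mul_le_mul_of_nonneg_left ((hsub x).trans (himp x)) (hd x))
    ⟨s, Finset.mem_univ s, mul_lt_mul_of_pos_left ?_ hds⟩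
  exact hlt.trans_le (hGθ ▸ himp s)
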